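/- Let 2 ≤ i ≤ n and let W be a positive word whose letters lie among a_1, …, a_{i−2}. Then in the positive braid monoid B⁺_{n+1} one has W^{Δ_{i−1}} Λ_i = Λ_i W^{Δ_i}. -/

import Mathlib

/-- Defining relations of the braid monoid/group on `n` strands' generators `Fin n`
(generator `i : Fin n` represents the Artin generator `a_{i+1}`):
braid relations `a_{i+1} a_i a_{i+1} = a_i a_{i+1} a_i` and
commutation `a_k a_s = a_s a_k` for `k - s ≥ 2`. -/
def braidRels (n : ℕ) : FreeMonoid (Fin n) → FreeMonoid (Fin n) → Prop := fun x y =>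
  (∃ i j : Fin n, (i : ℕ) + 1 = j ∧
      x = .of j * .of i * .of j ∧ y = .of i * .of j * .of i) ∨
  (∃ i j : Fin n, (i : ℕ) + 2 ≤ j ∧
      x = .of j * .of i ∧ y = .of i * .of j)

/-- The positive braid monoid `B⁺_{n+1}`. -/
def BraidMonoid (n : ℕ) : Type := PresentedMonoid (braidRels n)

instance (n : ℕ) : Monoid (BraidMonoid n) :=
  inferInstanceAs (Monoid (PresentedMonoid (braidRels n)))

/-- Relators of the braid group `B_{n+1}` on generators `Fin n`. -/
def braidRelators (n : ℕ) : Set (FreeGroup (Fin n)) :=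
  {r | (∃ i j : Fin n, (i : ℕ) + 1 = j ∧
          r = .of j * .of i * .of j * (.of i * .of j * .of i)⁻¹) ∨
       (∃ i j : Fin n, (i : ℕ) + 2 ≤ j ∧
          r = .of j * .of i * (.of i * .of j)⁻¹)}

/-- The braid group `B_{n+1}`. -/
def BraidGroup (n : ℕ) : Type := PresentedGroup (braidRelators n)

instance (n : ℕ) : Group (BraidGroup n) :=
  inferInstanceAs (Group (PresentedGroup (braidRelators n)))

namespace Braid

/-- The Artin generator `a_i` (`1 ≤ i ≤ n`) of the positive braid monoid;
junk value `1` outside this range. -/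
def a (n i : ℕ) : BraidMonoid n :=
  if h : 1 ≤ i ∧ i ≤ n then PresentedMonoid.of (braidRels n) ⟨i - 1, by omega⟩ else 1

/-- The Artin generator `a_i` (`1 ≤ i ≤ n`) of the braid group; junk value `1` otherwise. -/
def b (n i : ℕ) : BraidGroup n :=
  if h : 1 ≤ i ∧ i ≤ n then PresentedGroup.of (rels := braidRelators n) ⟨i - 1, by omega⟩ else 1

/-- The element of `B⁺_{n+1}` given by a positive word, i.e. a list of indices of
Artin generators. -/
def w (n : ℕ) (L : List ℕ) : BraidMonoid n := (L.map (a n)).prod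

/-- The element of `B_{n+1}` given by a positive word. -/
def wG (n : ℕ) (L : List ℕ) : BraidGroup n := (L.map (b n)).prod

/-- `Λ_i = a_i a_{i-1} ⋯ a_1`. -/
def Lam (n i : ℕ) : BraidMonoid n := ((List.range i).reverse.map (fun m => a n (m + 1))).prod

/-- `Λ_i^{(−)} = a_i a_{i-1} ⋯ a_2`  (`Λ_1^{(−)} = 1`). -/
def LamM (n i : ℕ) : BraidMonoid n :=
  ((List.range (i - 1)).reverse.map (fun m => a n (m + 2))).prod

/-- `Λ_i^{(−−)} = a_i a_{i-1} ⋯ a_3`  (`Λ_2^{(−−)} = 1`). -/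
def LamMM (n i : ℕ) : BraidMonoid n :=
  ((List.range (i - 2)).reverse.map (fun m => a n (m + 3))).prod

/-- `Δ_i = Λ_1 Λ_2 ⋯ Λ_i`. -/
def DeltaI (n i : ℕ) : BraidMonoid n := ((List.range i).map (fun m => Lam n (m + 1))).prod

/-- The Garside element `Δ = Λ_1 Λ_2 ⋯ Λ_n`. -/
def Delta (n : ℕ) : BraidMonoid n := DeltaI n n

/-- `Λ_i` in the braid group. -/
def LamG (n i : ℕ) : BraidGroup n := ((List.range i).reverse.map (fun m => b n (m + 1))).prod

/-- `Δ_i = Λ_1 Λ_2 ⋯ Λ_i` in the braid group. -/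
def DeltaIG (n i : ℕ) : BraidGroup n := ((List.range i).map (fun m => LamG n (m + 1))).prod

/-- The descending run `a_{ij} = a_i a_{i-1} ⋯ a_j` (`j ≤ i`), with `a_{i,i+1} = 1`. -/
def run (n i j : ℕ) : BraidMonoid n :=
  ((List.range (i + 1 - j)).reverse.map (fun m => a n (m + j))).prod

end Braid

namespace Braid

/-- The class in `B⁺_{n+1}` of a word in the free monoid. -/
def ofFree (n : ℕ) : FreeMonoid (Fin n) →* BraidMonoid n := PresentedMonoid.mk (braidRels n)

theorem ofFree_eq {n : ℕ} {x y : FreeMonoid (Fin n)} (h : braidRels n x y) :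
    ofFree n x = ofFree n y :=
  PresentedMonoid.mk_eq_mk_of_rel h

theorem a_eq {n i : ℕ} (h : 1 ≤ i ∧ i ≤ n) :
    a n i = ofFree n (.of ⟨i - 1, by omega⟩) :=
  dif_pos h

theorem commute_a_a {n i j : ℕ} (hi : 1 ≤ i) (hij : i + 2 ≤ j) (hj : j ≤ n) :
    Commute (a n j) (a n i) := by
  have hi' : 1 ≤ i ∧ i ≤ n := by omega
  have hj' : 1 ≤ j ∧ j ≤ n := by omega
  rw [Commute, SemiconjBy, a_eq hi', a_eq hj', ← map_mul, ← map_mul]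
  refine ofFree_eq (Or.inr ⟨_, _, ?_, rfl, rfl⟩)
  change i - 1 + 2 ≤ j - 1
  omega

theorem a_braid {n i : ℕ} (hi : 1 ≤ i) (hn : i + 1 ≤ n) :
    a n (i + 1) * a n i * a n (i + 1) = a n i * a n (i + 1) * a n i := by
  have hi' : 1 ≤ i ∧ i ≤ n := by omega
  have hj' : 1 ≤ i + 1 ∧ i + 1 ≤ n := by omega
  rw [a_eq hi', a_eq hj']
  simp only [← map_mul]
  refine ofFree_eq (Or.inl ⟨_, _, ?_, rfl, rfl⟩)
  change i - 1 + 1 = i + 1 - 1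
  omega

theorem Lam_succ (n i : ℕ) : Lam n (i + 1) = a n (i + 1) * Lam n i := by
  simp [Lam, List.range_succ]

theorem commute_a_Lam {n i j : ℕ} (hij : i + 2 ≤ j) (hj : j ≤ n) :
    Commute (a n j) (Lam n i) := by
  induction i with
  | zero => simp [Lam]
  | succ i ih =>
    rw [Lam_succ]
    exact (commute_a_a (by omega) (by omega) hj).mul_right (ih (by omega))

/-- `Λ_i a_{k+1} = a_k Λ_i` for `1 ≤ k < i`. -/
theorem semiconjBy_Lam {n i k : ℕ} (hk : 1 ≤ k) (hki : k + 1 ≤ i) (hi : i ≤ n) :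
    SemiconjBy (Lam n i) (a n (k + 1)) (a n k) := by
  induction i, hki using Nat.le_induction with
  | base =>
    obtain ⟨l, rfl⟩ := Nat.exists_eq_add_of_le' hk
    have hcomm := (commute_a_Lam (i := l) (j := l + 1 + 1) le_rfl hi).eq
    rw [SemiconjBy, Lam_succ, Lam_succ, mul_assoc, mul_assoc, ← hcomm]
    simp only [← mul_assoc]
    rw [a_braid hk hi]
  | succ i hki ih =>
    rw [Lam_succ]
    exact SemiconjBy.mul_left (commute_a_a hk (by omega) hi) (ih (by omega))

end Braid

/-- For `2 ≤ i ≤ n` and a positive word `W` in the letters `a_1, …, a_{i−2}`,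
in the positive braid monoid `B⁺_{n+1}` one has `W^{Δ_{i−1}} Λ_i = Λ_i W^{Δ_i}`. -/
theorem rev_word_mul_Lam (n i : ℕ) (hi1 : 2 ≤ i) (hi2 : i ≤ n) (W : List ℕ)
    (hW : ∀ m ∈ W, 1 ≤ m ∧ m ≤ i - 2) :
    Braid.w n (W.map (fun m => (i - 1) - m + 1)) * Braid.Lam n i
      = Braid.Lam n i * Braid.w n (W.map (fun m => i - m + 1)) := by
  induction W with
  | nil => simp [Braid.w]
  | cons m W ih =>
    simp only [List.forall_mem_cons] at hW
    have hletter := Braid.semiconjBy_Lam (n := n) (i := i) (k := i - m) (by omega) (by omega) hi2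
    have hword : SemiconjBy (Braid.Lam n i) _ _ := (ih hW.2).symm
    have hm : i - 1 - m + 1 = i - m := by omega
    simp only [Braid.w, List.map_cons, List.prod_cons, hm] at hword ⊢
    exact (hletter.mul_right hword).eq.symm
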